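/- arXiv:2511.16994 — 8 statements merged into one kernel-verified Lean document; each statement's English description precedes it below -/
import Mathlib

section
/- For all integers n ≥ 1 and k with 2 ≤ k ≤ n+1, the exponential partial Bell polynomials satisfy the recurrence B_{n+1,k}(x_1,…,x_{n+2-k}) = Σ_{r=0}^{n-k+1} (n choose r) · x_{r+1} · B_{n-r,k-1}(x_1,…,x_{n-r-k+2}). -/
open Finset

/-- The exponential partial Bell polynomial `B_{m,k}(x 1, …, x (m-k+1))`:
the sum over all tuples `(j_1, …, j_{m-k+1})` of nonnegative integers with
`j_1 + ⋯ + j_{m-k+1} = k` and `1·j_1 + ⋯ + (m-k+1)·j_{m-k+1} = m` of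
`m! / (j_1! ⋯ j_{m-k+1}!) · ∏ (x_i / i!)^{j_i}`. -/
noncomputable def bellPartial (m k : ℕ) (x : ℕ → ℂ) : ℂ :=
  ∑ j ∈ (Fintype.piFinset (fun _ : Fin (m - k + 1) => Finset.range (m + 1))).filter
      (fun (j : Fin (m - k + 1) → ℕ) => (∑ i : Fin (m - k + 1), j i) = k ∧ (∑ i : Fin (m - k + 1), ((i : ℕ) + 1) * j i) = m),
    (Nat.factorial m : ℂ) / (∏ i : Fin (m - k + 1), (Nat.factorial (j i) : ℂ)) *
      ∏ i : Fin (m - k + 1), (x ((i : ℕ) + 1) / (Nat.factorial ((i : ℕ) + 1) : ℂ)) ^ (j i)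

open PowerSeries in
/-- The exponential generating series `∑_{i ≥ 1} x i / i! · t ^ i`. -/
noncomputable def bellSeries (x : ℕ → ℂ) : PowerSeries ℂ :=
  X * PowerSeries.mk fun i => x (i + 1) / (Nat.factorial (i + 1) : ℂ)

open PowerSeries in
lemma coeff_bellSeries_pow_of_lt (x : ℕ → ℂ) {m k : ℕ} (h : m < k) :
    coeff m (bellSeries x ^ k) = 0 := by
  rw [bellSeries, mul_pow, coeff_X_pow_mul', if_neg (by omega)]

open PowerSeries in
lemma coeff_derivative_bellSeries (x : ℕ → ℂ) (r : ℕ) :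
    coeff r (PowerSeries.derivative ℂ (bellSeries x)) = x (r + 1) / (Nat.factorial r : ℂ) := by
  rw [PowerSeries.coeff_derivative, bellSeries, coeff_succ_X_mul, coeff_mk, Nat.factorial_succ]
  have h1 : (Nat.factorial r : ℂ) ≠ 0 := by exact_mod_cast Nat.factorial_ne_zero r
  have h2 : (r : ℂ) + 1 ≠ 0 := by exact_mod_cast Nat.succ_ne_zero r
  push_cast
  field_simp

open PowerSeries in
/-- Only the first `m - k + 1` terms of the series contribute to the coefficient of `t ^ m` in its
`k`-th power. -/
lemma coeff_bellSeries_pow (x : ℕ → ℂ) {m k : ℕ} (h : k ≤ m) :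
    coeff m (bellSeries x ^ k) =
      coeff m ((∑ i : Fin (m - k + 1),
        monomial ((i : ℕ) + 1) (x ((i : ℕ) + 1) / (Nat.factorial ((i : ℕ) + 1) : ℂ))) ^ k) := by
  set g : PowerSeries ℂ := PowerSeries.mk fun i => x (i + 1) / (Nat.factorial (i + 1) : ℂ) with hg
  have hs : (∑ i : Fin (m - k + 1),
        monomial ((i : ℕ) + 1) (x ((i : ℕ) + 1) / (Nat.factorial ((i : ℕ) + 1) : ℂ)))
      = X * (trunc (m - k + 1) g : PowerSeries ℂ) := by
    ext d
    rw [Fin.sum_univ_eq_sum_range (fun i => monomial (R := ℂ) (i + 1)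
      (x (i + 1) / (Nat.factorial (i + 1) : ℂ))), map_sum]
    rcases d with _ | d
    · simp [coeff_monomial]
    · simp [coeff_monomial, coeff_succ_X_mul, coeff_trunc, hg]
  rw [hs, bellSeries, ← hg, mul_pow, mul_pow, coeff_X_pow_mul', coeff_X_pow_mul', if_pos h,
    if_pos h]
  have ht := congrArg (fun p => Polynomial.coeff p (m - k)) (trunc_trunc_pow g (m - k + 1) k)
  simpa only [coeff_trunc, Nat.lt_succ_self, if_true] using ht.symm

open PowerSeries in
lemma prod_monomial_pow {ι : Type*} (s : Finset ι) (d j : ι → ℕ) (a : ι → ℂ) :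
    ∏ i ∈ s, monomial (d i) (a i) ^ j i
      = monomial (∑ i ∈ s, d i * j i) (∏ i ∈ s, a i ^ j i) := by
  simp_rw [monomial_pow, mul_comm (j _)]
  induction s using Finset.cons_induction with
  | empty => simp
  | cons i s hi ih => rw [prod_cons, sum_cons, prod_cons, ih, monomial_mul_monomial]

/-- Partial Bell polynomials are the coefficients of the powers of `bellSeries`. -/
lemma bellPartial_eq_coeff (x : ℕ → ℂ) {m k : ℕ} (h : k ≤ m) :
    bellPartial m k x = (Nat.factorial m : ℂ) / (Nat.factorial k : ℂ) *
      PowerSeries.coeff m (bellSeries x ^ k) := by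
  have hset : (Fintype.piFinset (fun _ : Fin (m - k + 1) => Finset.range (m + 1))).filter
      (fun j => (∑ i, j i) = k ∧ (∑ i : Fin (m - k + 1), ((i : ℕ) + 1) * j i) = m)
      = (Finset.piAntidiag univ k).filter
        (fun j => (∑ i : Fin (m - k + 1), ((i : ℕ) + 1) * j i) = m) := by
    ext j
    simp only [mem_filter, Fintype.mem_piFinset, mem_range, mem_piAntidiag, mem_univ]
    refine ⟨fun hj => ⟨⟨hj.2.1, by simp⟩, hj.2.2⟩, fun hj => ⟨fun i => ?_, hj.1.1, hj.2⟩⟩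
    have := Finset.single_le_sum (f := fun i : Fin (m - k + 1) => ((i : ℕ) + 1) * j i)
      (fun _ _ => Nat.zero_le _) (mem_univ i)
    nlinarith [hj.2, Nat.zero_le ((i : ℕ) * j i)]
  rw [bellPartial, hset, coeff_bellSeries_pow x h, Finset.sum_pow_eq_sum_piAntidiag, map_sum,
    Finset.sum_filter, Finset.mul_sum]
  refine Finset.sum_congr rfl fun j hj => ?_
  have hk : ∑ i, j i = k := (mem_piAntidiag.mp hj).1
  have hspec := congrArg (Nat.cast (R := ℂ)) (Nat.multinomial_spec univ j)
  rw [hk] at hspec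
  push_cast at hspec
  have hk0 : (Nat.factorial k : ℂ) ≠ 0 := by exact_mod_cast Nat.factorial_ne_zero k
  have hp0 : (∏ i, (Nat.factorial (j i) : ℂ)) ≠ 0 :=
    Finset.prod_ne_zero_iff.mpr fun i _ => by exact_mod_cast Nat.factorial_ne_zero (j i)
  rw [prod_monomial_pow, ← map_natCast (PowerSeries.C (R := ℂ)), PowerSeries.coeff_C_mul,
    PowerSeries.coeff_monomial]
  split_ifs with h1 h2 h2
  · field_simp
    rw [← hspec]
    ring
  · exact absurd h1.symm h2
  · exact absurd h2.symm h1
  · simp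

lemma bellPartial_eq_zero (x : ℕ → ℂ) {m k : ℕ} (h : m < k) : bellPartial m k x = 0 := by
  refine Finset.sum_eq_zero fun j hj => ?_
  obtain ⟨-, h1, h2⟩ := mem_filter.mp hj
  have : ∑ i, j i ≤ ∑ i : Fin (m - k + 1), ((i : ℕ) + 1) * j i :=
    Finset.sum_le_sum fun i _ => Nat.le_mul_of_pos_left _ (Nat.succ_pos _)
  omega

open PowerSeries in
/-- The coefficientwise form of `(F ^ (k + 1))' = (k + 1) F' F ^ k`. -/
lemma coeff_bellSeries_pow_succ (x : ℕ → ℂ) (n k : ℕ) :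
    ((n : ℂ) + 1) * coeff (n + 1) (bellSeries x ^ (k + 1)) =
      ((k : ℂ) + 1) * ∑ r ∈ Finset.range (n + 1),
        x (r + 1) / (Nat.factorial r : ℂ) * coeff (n - r) (bellSeries x ^ k) := by
  have h : PowerSeries.derivative ℂ (bellSeries x ^ (k + 1)) =
      C ((k : ℂ) + 1) * (PowerSeries.derivative ℂ (bellSeries x) * bellSeries x ^ k) := by
    rw [PowerSeries.derivative_pow, Nat.add_sub_cancel, map_add, map_natCast, map_one]
    push_cast
    ring
  have hc := congrArg (coeff n) h
  rw [PowerSeries.coeff_derivative, coeff_C_mul, coeff_mul,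
    Finset.Nat.sum_antidiagonal_eq_sum_range_succ_mk] at hc
  simp only [coeff_derivative_bellSeries] at hc
  rw [mul_comm, hc]

/-- For `n ≥ 1` and `2 ≤ k ≤ n + 1`, the exponential partial Bell polynomials satisfy
`B_{n+1,k}(x_1,…,x_{n+2-k}) = ∑_{r=0}^{n-k+1} (n choose r) · x_{r+1} · B_{n-r,k-1}`. -/
theorem bellPartial_recurrence (n k : ℕ) (hn : 1 ≤ n) (hk2 : 2 ≤ k) (hkn : k ≤ n + 1)
    (x : ℕ → ℂ) :
    bellPartial (n + 1) k x
      = ∑ r ∈ Finset.range (n - k + 2),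
          (Nat.choose n r : ℂ) * x (r + 1) * bellPartial (n - r) (k - 1) x := by
  obtain ⟨k, rfl⟩ : ∃ l, k = l + 1 := ⟨k - 1, by omega⟩
  have hsub : Finset.range (n - (k + 1) + 2) ⊆ Finset.range (n + 1) :=
    Finset.range_subset_range.mpr (by omega)
  rw [Nat.add_sub_cancel, Finset.sum_subset hsub fun r _ hr => by
    rw [mem_range] at hr
    rw [bellPartial_eq_zero x (by omega), mul_zero]]
  have hk0 : (Nat.factorial k : ℂ) ≠ 0 := by exact_mod_cast Nat.factorial_ne_zero k
  have hk1 : (k : ℂ) + 1 ≠ 0 := by exact_mod_cast Nat.succ_ne_zero k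
  have hrec : bellPartial (n + 1) (k + 1) x = (Nat.factorial n : ℂ) / (Nat.factorial k : ℂ) *
      ∑ r ∈ Finset.range (n + 1),
        x (r + 1) / (Nat.factorial r : ℂ) * PowerSeries.coeff (n - r) (bellSeries x ^ k) := by
    rw [bellPartial_eq_coeff x hkn, Nat.factorial_succ, Nat.factorial_succ]
    have hcoeff := coeff_bellSeries_pow_succ x n k
    generalize ∑ r ∈ Finset.range (n + 1),
      x (r + 1) / (Nat.factorial r : ℂ) * PowerSeries.coeff (n - r) (bellSeries x ^ k) = S
      at hcoeff ⊢
    push_cast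
    field_simp
    linear_combination (Nat.factorial n : ℂ) * hcoeff
  rw [hrec, Finset.mul_sum]
  refine Finset.sum_congr rfl fun r hr => ?_
  have hrn : r ≤ n := by
    rw [mem_range] at hr
    omega
  rcases lt_or_ge (n - r) k with hlt | hge
  · rw [bellPartial_eq_zero x hlt, coeff_bellSeries_pow_of_lt x hlt, mul_zero, mul_zero, mul_zero]
  · rw [bellPartial_eq_coeff x hge, Nat.cast_choose ℂ hrn]
    have h1 : (Nat.factorial r : ℂ) ≠ 0 := by exact_mod_cast Nat.factorial_ne_zero r
    have h2 : (Nat.factorial (n - r) : ℂ) ≠ 0 := by exact_mod_cast Nat.factorial_ne_zero (n - r)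
    field_simp
end

section
/- Let m ≥ 1, c ∈ ℂ with c ≠ 0, and λ ∈ ℂ with λ ≠ 0. Suppose x = (x_1,…,x_m) : U → ℂ^m is differentiable on an open set U ⊆ ℂ and satisfies x_i'(z) = f_i^A(x(z)) for all z ∈ U and i = 1,…,m. Then the rescaled functions y_i(z) := λ^i · x_i(λ·z), defined on {z : λ·z ∈ U}, also satisfy y_i'(z) = f_i^A(y(z)) for all i = 1,…,m. -/
/-- The autonomous Riccati chain vector field on `ℂ^m`:
`f_k(x) = x_{k+1} − c·x_1·x_k` for `1 ≤ k ≤ m−1` and `f_m(x) = −c·x_1·x_m`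
(here indices are shifted so that `k : Fin m` represents the coordinate `k+1`). -/
def riccatiField (m : ℕ) (c : ℂ) (x : Fin m → ℂ) (k : Fin m) : ℂ :=
  (if h : (k : ℕ) + 1 < m then x ⟨(k : ℕ) + 1, h⟩ else 0) - c * x ⟨0, k.pos⟩ * x k

/-- The Riccati chain vector field is quasi-homogeneous: coordinate `i` has weight `i + 1` and
the field raises the weight by one. -/
theorem riccatiField_rescale (m : ℕ) (c lam : ℂ) (v : Fin m → ℂ) (i : Fin m) :
    riccatiField m c (fun j => lam ^ ((j : ℕ) + 1) * v j) i =
      lam ^ ((i : ℕ) + 1) * (riccatiField m c v i * lam) := by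
  unfold riccatiField
  split_ifs <;> ring

/-- Rescaling invariance of solutions of the autonomous Riccati chain: if `x` solves
`x_i' = f_i(x)` on an open set `U`, then `y_i(z) := lam^i · x_i(lam·z)` solves the same
system at every `z` with `lam·z ∈ U`. -/
theorem riccatiField_solution_rescale (m : ℕ) (hm : 1 ≤ m) (c : ℂ) (hc : c ≠ 0)
    (lam : ℂ) (hlam : lam ≠ 0) (U : Set ℂ) (hU : IsOpen U) (x : Fin m → ℂ → ℂ)
    (hx : ∀ z ∈ U, ∀ i : Fin m,
      HasDerivAt (x i) (riccatiField m c (fun j => x j z) i) z)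
    (z : ℂ) (hz : lam * z ∈ U) (i : Fin m) :
    HasDerivAt (fun w => lam ^ ((i : ℕ) + 1) * x i (lam * w))
      (riccatiField m c (fun j => lam ^ ((j : ℕ) + 1) * x j (lam * z)) i) z := by
  have hinner : HasDerivAt (fun w => lam * w) lam z := by
    simpa using (hasDerivAt_id z).const_mul lam
  rw [riccatiField_rescale m c lam (fun j => x j (lam * z))]
  exact ((hx _ hz i).comp z hinner).const_mul _
end

section
/- Let m ≥ 1, c ∈ ℂ with c ≠ 0, and let n ∈ {1,…,m}. Define ξ^{(n)} ∈ ℂ^m by ξ^{(n)}_k = (n)_k / c for 1 ≤ k ≤ n and ξ^{(n)}_k = 0 for n < k ≤ m, where (n)_k = n(n−1)⋯(n−k+1) is the falling factorial. Then ξ^{(n)} satisfies the indicial equations −k·ξ_k = f_k^A(ξ) for all k = 1,…,m. -/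
/-- The falling factorial recursion `(n)_{k+1} = (n - k) (n)_k`, with the subtraction taken
in the ring. -/
theorem cast_descFactorial_succ {R : Type*} [Ring R] (n k : ℕ) :
    (n.descFactorial (k + 1) : R) = ((n : R) - k) * n.descFactorial k := by
  rcases le_or_gt k n with h | h
  · rw [Nat.descFactorial_succ, Nat.cast_mul, Nat.cast_sub h]
  · rw [Nat.descFactorial_eq_zero_iff_lt.mpr h,
      Nat.descFactorial_eq_zero_iff_lt.mpr (h.trans k.lt_succ_self), Nat.cast_zero, mul_zero]

/-- The vectors `ξ^{(n)}` with `ξ^{(n)}_k = (n)_k / c` for `k ≤ n` and `0` for `k > n`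
(with `(n)_k` the falling factorial) satisfy the indicial equations
`−k·ξ_k = f_k(ξ)` of the autonomous Riccati chain. -/
theorem riccatiField_indicial_locus (m : ℕ) (hm : 1 ≤ m) (c : ℂ) (hc : c ≠ 0)
    (n : ℕ) (hn1 : 1 ≤ n) (hnm : n ≤ m) (ξ : Fin m → ℂ)
    (hξ : ξ = fun k : Fin m =>
      if (k : ℕ) + 1 ≤ n then (Nat.descFactorial n ((k : ℕ) + 1) : ℂ) / c else 0)
    (k : Fin m) :
    -(((k : ℕ) + 1 : ℂ)) * ξ k = riccatiField m c ξ k := by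
  have hξ' : ∀ j : Fin m, ξ j = (n.descFactorial ((j : ℕ) + 1) : ℂ) / c := by
    intro j
    rw [hξ]
    dsimp only
    split_ifs with h
    · rfl
    · rw [Nat.descFactorial_eq_zero_iff_lt.mpr (by omega), Nat.cast_zero, zero_div]
  have hnext : (if h : (k : ℕ) + 1 < m then ξ ⟨(k : ℕ) + 1, h⟩ else 0) =
      (n.descFactorial ((k : ℕ) + 1 + 1) : ℂ) / c := by
    split_ifs with h
    · exact hξ' _
    · rw [Nat.descFactorial_eq_zero_iff_lt.mpr (by omega), Nat.cast_zero, zero_div]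
  rw [riccatiField, hnext, hξ', hξ', cast_descFactorial_succ n ((k : ℕ) + 1)]
  simp only [zero_add, Nat.descFactorial_one]
  field_simp
  push_cast
  ring
end

section
/- Let m ≥ 1, c ∈ ℂ with c ≠ 0, n ∈ {1,…,m}, and z_0 ∈ ℂ. Define x_k(z) = ((n)_k / c)·(z − z_0)^{−k} for k = 1,…,m, where (n)_k = n(n−1)⋯(n−k+1) is the falling factorial. Then for every z ≠ z_0, these functions satisfy the autonomous Riccati chain system: x_k'(z) = x_{k+1}(z) − c·x_1(z)·x_k(z) for 1 ≤ k ≤ m−1, and x_m'(z) = −c·x_1(z)·x_m(z). -/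
/-- The recursion `(n)_{j+1} = (n)_j (n - j)` for falling factorials, with the subtraction
carried out in the ring. -/
theorem cast_descFactorial_succ_eq_mul_sub {R : Type*} [CommRing R] (n j : ℕ) :
    (n.descFactorial (j + 1) : R) = n.descFactorial j * ((n : R) - j) := by
  rcases le_or_gt j n with h | h
  · rw [Nat.descFactorial_succ, Nat.cast_mul, Nat.cast_sub h, mul_comm]
  · simp [Nat.descFactorial_of_lt h]

/-- The Laurent-type functions `x_k(z) = ((n)_k / c)·(z − z₀)^{−k}` solve the
autonomous Riccati chain system `x_k' = f_k(x)` at every `z ≠ z₀`. -/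
theorem riccatiField_laurent_solution (m : ℕ) (hm : 1 ≤ m) (c : ℂ) (hc : c ≠ 0)
    (n : ℕ) (hn1 : 1 ≤ n) (hnm : n ≤ m) (z₀ : ℂ) (x : Fin m → ℂ → ℂ)
    (hx : x = fun (k : Fin m) (z : ℂ) =>
      ((Nat.descFactorial n ((k : ℕ) + 1) : ℂ) / c) * (z - z₀) ^ (-(((k : ℕ) : ℤ) + 1)))
    (z : ℂ) (hz : z ≠ z₀) (k : Fin m) :
    HasDerivAt (x k) (riccatiField m c (fun j => x j z) k) z := by
  subst hx
  have hw : z - z₀ ≠ 0 := sub_ne_zero.mpr hz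
  have hnext : (if h : (k : ℕ) + 1 < m then
      ((Nat.descFactorial n ((k : ℕ) + 1 + 1) : ℂ) / c)
        * (z - z₀) ^ (-((((k : ℕ) + 1 : ℕ) : ℤ) + 1)) else 0)
      = ((Nat.descFactorial n ((k : ℕ) + 1) * ((n : ℂ) - ((k : ℕ) + 1 : ℕ))) / c)
        * (z - z₀) ^ (-((((k : ℕ) + 1 : ℕ) : ℤ) + 1)) := by
    rw [← cast_descFactorial_succ_eq_mul_sub]
    split_ifs with h
    · rfl
    · rw [Nat.descFactorial_of_lt (show n < (k : ℕ) + 1 + 1 by lia), Nat.cast_zero, zero_div,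
        zero_mul]
  have hderiv := (((hasDerivAt_zpow (-(((k : ℕ) : ℤ) + 1)) (z - z₀) (Or.inl hw)).comp z
    ((hasDerivAt_id z).sub_const z₀)).const_mul ((Nat.descFactorial n ((k : ℕ) + 1) : ℂ) / c))
  refine hderiv.congr_deriv ?_
  simp only [riccatiField]
  rw [hnext]
  have hpow : (z - z₀) ^ (-((((k : ℕ) + 1 : ℕ) : ℤ) + 1))
      = (z - z₀) ^ (-(((k : ℕ) : ℤ) + 1)) * (z - z₀)⁻¹ := by
    rw [← zpow_sub_one₀ hw]
    congr 1
  rw [hpow, zpow_sub_one₀ hw]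
  simp only [Nat.cast_zero, zero_add, Nat.descFactorial_one, zpow_neg_one]
  push_cast
  field_simp
  ring
end

section
/- Let m ≥ 1 and n ∈ {1,…,m}, and let K^{(n)} be the Kovalevskaya matrix of the autonomous Riccati chain at the indicial locus ξ^{(n)}. Then the characteristic polynomial of K^{(n)} satisfies det(K^{(n)} − λ·I) = (∏_{k=0}^{n−1} (k − n − λ)) · (∏_{k=n+1}^{m} (k − n − λ)) for all λ ∈ ℂ. -/
/-- The Kovalevskaya matrix `K^{(n)}` of the autonomous Riccati chain at the indicial
locus `ξ^{(n)}` (1-indexed entries: `K_{11} = 1 − 2n`, `K_{ii} = i − n` for `2 ≤ i ≤ m`,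
`K_{i,i+1} = 1` for `1 ≤ i ≤ m−1`, `K_{i,1} = −(n)_i` for `2 ≤ i ≤ n`, all other
entries `0`), written here with `0`-indexed rows and columns. -/
def kovalevskayaMatrix (m n : ℕ) : Matrix (Fin m) (Fin m) ℂ :=
  fun i j =>
    if (i : ℕ) = 0 ∧ (j : ℕ) = 0 then 1 - 2 * (n : ℂ)
    else if (j : ℕ) = (i : ℕ) + 1 then 1
    else if i = j then ((i : ℕ) + 1 : ℂ) - (n : ℂ)
    else if (j : ℕ) = 0 ∧ 2 ≤ (i : ℕ) + 1 ∧ (i : ℕ) + 1 ≤ n then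
      -(Nat.descFactorial n ((i : ℕ) + 1) : ℂ)
    else 0

open Finset in
/-- An alternating sum of falling factorials of `n` against the products `∏_{k=j+1}^{n} (k - x)`
collapses to `∏_{k=0}^{n-1} (k - x)`. -/
theorem sum_alternating_descFactorial_mul_prod {R : Type*} [CommRing R] (n : ℕ) (x : R) :
    ∑ j ∈ range (n + 1), (-1) ^ j * (n.descFactorial j : R) *
        ∏ k ∈ Ico (j + 1) (n + 1), ((k : R) - x) = ∏ k ∈ range n, ((k : R) - x) := by
  induction n generalizing x with
  | zero => simp
  | succ n ih =>
    have hshift : ∑ j ∈ range (n + 1), (-1) ^ (j + 1) * ((n + 1).descFactorial (j + 1) : R) *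
        ∏ k ∈ Ico (j + 1 + 1) (n + 1 + 1), ((k : R) - x)
        = -((n : R) + 1) * ∏ k ∈ range n, ((k : R) - (x - 1)) := by
      rw [← ih (x - 1), mul_sum]
      refine sum_congr rfl fun j _ => ?_
      rw [← prod_Ico_add' (fun k : ℕ => (k : R) - x) (j + 1) (n + 1) 1,
        Nat.succ_descFactorial_succ]
      have hprod : ∏ k ∈ Ico (j + 1) (n + 1), (((k + 1 : ℕ) : R) - x)
          = ∏ k ∈ Ico (j + 1) (n + 1), ((k : R) - (x - 1)) :=
        prod_congr rfl fun k _ => by push_cast; ring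
      rw [hprod]
      push_cast
      ring
    have hfirst : ∏ k ∈ Ico (0 + 1) (n + 1 + 1), ((k : R) - x)
        = (∏ k ∈ range n, ((k : R) - (x - 1))) * ((n : R) + 1 - x) := by
      rw [← prod_Ico_add' (fun k : ℕ => (k : R) - x) 0 (n + 1) 1, ← range_eq_Ico,
        prod_range_succ]
      push_cast
      congr 1
      exact prod_congr rfl fun k _ => by ring
    have hlast : ∏ k ∈ range (n + 1), ((k : R) - x)
        = (∏ k ∈ range n, ((k : R) - (x - 1))) * -x := by
      rw [prod_range_succ']
      push_cast
      rw [zero_sub]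
      congr 1
      exact prod_congr rfl fun k _ => by ring
    rw [sum_range_succ', hshift, hfirst, hlast]
    simp only [pow_zero, Nat.descFactorial_zero, Nat.cast_one]
    ring

/-- The matrix with first column `c`, remaining diagonal `d`, superdiagonal `1`, and all other
entries `0`. -/
def borderedBidiagonal {R : Type*} [CommRing R] (c d : ℕ → R) (m : ℕ) :
    Matrix (Fin m) (Fin m) R :=
  fun i j =>
    if (j : ℕ) = 0 then c i
    else if (j : ℕ) = i + 1 then 1
    else if (i : ℕ) = j then d i
    else 0

/-- Laplace expansion of `borderedBidiagonal` along its last row. -/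
theorem det_borderedBidiagonal_succ {R : Type*} [CommRing R] (c d : ℕ → R) (m : ℕ) :
    (borderedBidiagonal c d (m + 2)).det
      = d (m + 1) * (borderedBidiagonal c d (m + 1)).det + (-1) ^ (m + 1) * c (m + 1) := by
  have hminor_last : (borderedBidiagonal c d (m + 2)).submatrix
      (Fin.last (m + 1)).succAbove (Fin.last (m + 1)).succAbove
        = borderedBidiagonal c d (m + 1) := by
    ext i j
    simp [borderedBidiagonal]
  have hminor_zero : ((borderedBidiagonal c d (m + 2)).submatrix
      (Fin.last (m + 1)).succAbove (Fin.succAbove 0)).det = 1 := by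
    rw [Matrix.det_of_isLowerTriangular]
    · exact Finset.prod_eq_one fun i _ => by simp [borderedBidiagonal]
    · intro i j hij
      have hlt : (i : ℕ) < j := hij
      have hne : (j : ℕ) ≠ i := by omega
      have hne' : (i : ℕ) ≠ j + 1 := by omega
      simp [borderedBidiagonal, hne, hne']
  rw [Matrix.det_succ_row _ (Fin.last (m + 1)), Fin.sum_univ_castSucc, Fin.sum_univ_succ,
    Finset.sum_eq_zero, hminor_last]
  · rw [Fin.castSucc_zero, hminor_zero]
    have hsign : (-1 : R) ^ (m + 1 + (m + 1)) = 1 := Even.neg_one_pow ⟨m + 1, rfl⟩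
    simp only [borderedBidiagonal, Fin.val_last, Fin.val_zero, hsign]
    simp
    ring
  · intro j _
    have hj : (j : ℕ) < m := j.isLt
    have h1 : (j : ℕ) ≠ m + 1 := by omega
    have h2 : m ≠ (j : ℕ) := by omega
    simp [borderedBidiagonal, h1, h2]

theorem kovalevskayaMatrix_sub_smul_one (m n : ℕ) (lam : ℂ) :
    kovalevskayaMatrix m n - lam • (1 : Matrix (Fin m) (Fin m) ℂ)
      = borderedBidiagonal
          (fun i => if i = 0 then 1 - 2 * (n : ℂ) - lam else -(n.descFactorial (i + 1) : ℂ))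
          (fun i => ((i + 1 : ℕ) : ℂ) - (n + lam)) m := by
  ext i j
  have hdesc : n < (i : ℕ) + 1 → n.descFactorial ((i : ℕ) + 1) = 0 :=
    Nat.descFactorial_of_lt
  simp only [kovalevskayaMatrix, borderedBidiagonal, Matrix.sub_apply, Matrix.smul_apply,
    Matrix.one_apply, Fin.ext_iff, smul_eq_mul]
  push_cast
  split_ifs <;> first | omega | (ring; done) | (rw [hdesc (by omega)]; simp)

open Finset in
/-- The determinants of all sizes, for a fixed index `n` not bounded by the size. -/
theorem det_kovalevskayaMatrix_sub_eq_sum (m n : ℕ) (lam : ℂ) :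
    (kovalevskayaMatrix (m + 1) n - lam • (1 : Matrix (Fin (m + 1)) (Fin (m + 1)) ℂ)).det
      = ∑ j ∈ range (m + 2), (-1) ^ j * (n.descFactorial j : ℂ) *
        ∏ k ∈ Ico (j + 1) (m + 2), ((k : ℂ) - (n + lam)) := by
  rw [kovalevskayaMatrix_sub_smul_one]
  induction m with
  | zero =>
    simp [borderedBidiagonal, sum_range_succ]
    ring
  | succ m ih =>
    rw [det_borderedBidiagonal_succ, ih, sum_range_succ _ (m + 2), mul_sum]
    congr 1
    · refine sum_congr rfl fun j hj => ?_
      have hjm : j + 1 ≤ m + 2 := mem_range.mp hj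
      rw [prod_Ico_succ_top hjm]
      push_cast
      ring
    · simp
      ring

/-- The characteristic polynomial of the Kovalevskaya matrix of the Riccati chain:
`det(K^{(n)} − lam·I) = (∏_{k=0}^{n−1} (k − n − lam)) · (∏_{k=n+1}^{m} (k − n − lam))`. -/
theorem kovalevskayaMatrix_charpoly (m n : ℕ) (hm : 1 ≤ m) (hn1 : 1 ≤ n) (hnm : n ≤ m)
    (lam : ℂ) :
    (kovalevskayaMatrix m n - lam • (1 : Matrix (Fin m) (Fin m) ℂ)).det
      = (∏ k ∈ Finset.range n, ((k : ℂ) - (n : ℂ) - lam)) *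
        (∏ k ∈ Finset.Icc (n + 1) m, ((k : ℂ) - (n : ℂ) - lam)) := by
  have hsplit : ∏ k ∈ Finset.Icc (n + 1) m, ((k : ℂ) - (n : ℂ) - lam)
      = ∏ k ∈ Finset.Ico (n + 1) (m + 1), ((k : ℂ) - (n + lam)) :=
    Finset.prod_congr rfl fun k _ => by ring
  have hhead : ∏ k ∈ Finset.range n, ((k : ℂ) - (n : ℂ) - lam)
      = ∏ k ∈ Finset.range n, ((k : ℂ) - (n + lam)) :=
    Finset.prod_congr rfl fun k _ => by ring
  obtain ⟨l, rfl⟩ : ∃ l, m = l + 1 := ⟨m - 1, by omega⟩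
  rw [det_kovalevskayaMatrix_sub_eq_sum, hsplit, hhead,
    ← sum_alternating_descFactorial_mul_prod, Finset.sum_mul]
  symm
  refine (Finset.sum_congr rfl fun j hj => ?_).trans
    (Finset.sum_subset (Finset.range_mono (by omega : n + 1 ≤ l + 2)) fun j _ hj => ?_)
  · have hjn : j + 1 ≤ n + 1 := by have := Finset.mem_range.mp hj; omega
    rw [mul_assoc, Finset.prod_Ico_consecutive _ hjn (by omega)]
  · rw [Nat.descFactorial_of_lt (by have := mt Finset.mem_range.mpr hj; omega)]
    simp
end

section
/- Let m ≥ 1 and n ∈ {1,…,m}, and let K^{(n)} be the Kovalevskaya matrix of the autonomous Riccati chain at the indicial locus ξ^{(n)}. Then the set of eigenvalues of K^{(n)} is exactly {k − n : k ∈ {0,1,…,m}, k ≠ n}; that is, the Kovalevskaya exponents are −n, −n+1, …, −1, 1, 2, …, m−n. -/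
/-- The forward solution of the eigenvector equation of `K^{(n)}` for the eigenvalue `l - n`,
normalised to have first coordinate `1`. -/
noncomputable def kovalevskayaSeq (n : ℕ) (l : ℂ) : ℕ → ℂ
  | 0 => 1
  | i + 1 => (l - (i + 1)) * kovalevskayaSeq n l i + (n.descFactorial (i + 1) : ℂ)

theorem kovalevskayaMatrix_apply (m n : ℕ) (i j : Fin m) :
    kovalevskayaMatrix m n i j =
      (if (j : ℕ) = i + 1 then 1 else 0) + (if (j : ℕ) = i then ((i : ℕ) + 1 : ℂ) - n else 0)
        - (if (j : ℕ) = 0 then (n.descFactorial (i + 1) : ℂ) else 0) := by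
  obtain ⟨i, hi⟩ := i
  obtain ⟨j, hj⟩ := j
  simp only [kovalevskayaMatrix, Fin.mk.injEq]
  rcases Nat.eq_zero_or_pos j with rfl | hj0
  · rcases Nat.eq_zero_or_pos i with rfl | hi0
    · simp
      ring
    · by_cases hin : i + 1 ≤ n
      · have h : 2 ≤ i + 1 := by omega
        simp [hi0.ne', hi0.ne, hin, h]
      · have h : n.descFactorial (i + 1) = 0 := Nat.descFactorial_eq_zero_iff_lt.2 (by omega)
        rw [h]
        simp [hi0.ne', hi0.ne, hin]
  · by_cases h1 : j = i + 1
    · simp [h1]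
    · by_cases h2 : j = i
      · subst h2
        simp [hj0.ne']
      · simp [h1, h2, Ne.symm h2, hj0.ne']

theorem kovalevskayaMatrix_mulVec (m n : ℕ) (x : ℕ → ℂ) (hx : x m = 0) (i : Fin m) :
    (kovalevskayaMatrix m n).mulVec (fun j => x j) i =
      x (i + 1) + ((i : ℕ) + 1 - n) * x i - n.descFactorial (i + 1) * x 0 := by
  have hi := i.isLt
  have hm : 0 < m := by omega
  simp only [Matrix.mulVec, dotProduct, kovalevskayaMatrix_apply]
  rw [Fin.sum_univ_eq_sum_range (fun j => ((if j = (i : ℕ) + 1 then 1 else 0)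
    + (if j = (i : ℕ) then ((i : ℕ) + 1 : ℂ) - n else 0)
        - (if j = 0 then (n.descFactorial (i + 1) : ℂ) else 0)) * x j)]
  simp only [sub_mul, add_mul, Finset.sum_sub_distrib, Finset.sum_add_distrib, ite_mul, zero_mul,
    Finset.sum_ite_eq', Finset.mem_range, hi, hm, if_true, one_mul]
  split_ifs with h
  · rfl
  · rw [show (i : ℕ) + 1 = m by omega, hx]

theorem mem_spectrum_kovalevskayaMatrix_iff {m n : ℕ} (hm : 1 ≤ m) (μ : ℂ) :
    μ ∈ spectrum ℂ (kovalevskayaMatrix m n) ↔ kovalevskayaSeq n (μ + n) m = 0 := by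
  rw [← Matrix.spectrum_toLin', ← Module.End.hasEigenvalue_iff_mem_spectrum]
  constructor
  · intro h
    obtain ⟨v, hv⟩ := h.exists_hasEigenvector
    have hKv := hv.apply_eq_smul
    rw [Matrix.toLin'_apply] at hKv
    let x : ℕ → ℂ := fun k => if h : k < m then v ⟨k, h⟩ else 0
    have hxm : x m = 0 := by simp [x]
    have hxv : (fun j : Fin m => x j) = v := by
      ext j
      simp [x]
    have hsol : ∀ k ≤ m, x k = x 0 * kovalevskayaSeq n (μ + n) k := by
      intro k
      induction k with
      | zero => simp [kovalevskayaSeq]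
      | succ k ih =>
        intro hk
        have hrow := kovalevskayaMatrix_mulVec m n x hxm ⟨k, hk⟩
        rw [hxv, hKv, ← hxv] at hrow
        simp only [Pi.smul_apply, smul_eq_mul] at hrow
        have hk' := ih (by omega)
        rw [kovalevskayaSeq]
        linear_combination (μ + n - (k + 1)) * hk' - hrow
    have hx0 : x 0 ≠ 0 := by
      intro h0
      apply hv.2
      rw [← hxv]
      ext j
      simp [hsol j j.isLt.le, h0]
    exact (mul_eq_zero.1 ((hsol m le_rfl).symm.trans hxm)).resolve_left hx0
  · intro h
    refine Module.End.hasEigenvalue_of_hasEigenvector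
      (x := fun j : Fin m => kovalevskayaSeq n (μ + n) j) ?_
    rw [Module.End.hasEigenvector_iff, Module.End.mem_eigenspace_iff]
    refine ⟨?_, fun h0 => ?_⟩
    · ext i
      rw [Matrix.toLin'_apply, kovalevskayaMatrix_mulVec m n _ h]
      simp only [kovalevskayaSeq, Pi.smul_apply, smul_eq_mul]
      ring
    · simpa [kovalevskayaSeq] using congrFun h0 ⟨0, hm⟩

theorem sub_mul_kovalevskayaSeq (n : ℕ) (l : ℂ) (i : ℕ) :
    (l - n) * kovalevskayaSeq n l i =
      ∏ k ∈ Finset.range (i + 1), (l - k) - (n.descFactorial (i + 1) : ℂ) := by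
  induction i with
  | zero => simp [kovalevskayaSeq]
  | succ i ih =>
    have hd : (n.descFactorial (i + 1 + 1) : ℂ) = (n - (i + 1)) * n.descFactorial (i + 1) := by
      rw [Nat.descFactorial_succ n (i + 1)]
      rcases le_or_gt (i + 1) n with h | h
      · push_cast [Nat.cast_sub h]
        ring
      · rw [Nat.descFactorial_eq_zero_iff_lt.2 h]
        simp
    rw [Finset.prod_range_succ, hd, kovalevskayaSeq]
    push_cast
    linear_combination (l - (i + 1)) * ih

theorem kovalevskayaSeq_self_eq_natCast {n i : ℕ} (hi : i ≤ n) :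
    ∃ c : ℕ, 0 < c ∧ kovalevskayaSeq n n i = c := by
  induction i with
  | zero => exact ⟨1, one_pos, by simp [kovalevskayaSeq]⟩
  | succ i ih =>
    obtain ⟨c, -, h⟩ := ih (by omega)
    refine ⟨(n - (i + 1)) * c + n.descFactorial (i + 1),
      Nat.add_pos_right _ (Nat.descFactorial_pos.2 hi), ?_⟩
    rw [kovalevskayaSeq, h]
    push_cast [Nat.cast_sub hi]
    ring

theorem kovalevskayaSeq_self_ne_zero {n m : ℕ} (h : n ≤ m) : kovalevskayaSeq n n m ≠ 0 := by
  induction m, h using Nat.le_induction with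
  | base =>
    obtain ⟨c, hc, h⟩ := kovalevskayaSeq_self_eq_natCast (le_refl n)
    rw [h]
    exact_mod_cast hc.ne'
  | succ m hnm ih =>
    rw [kovalevskayaSeq, Nat.descFactorial_eq_zero_iff_lt.2 (by omega), Nat.cast_zero, add_zero]
    refine mul_ne_zero (sub_ne_zero.2 ?_) ih
    exact_mod_cast (by omega : n ≠ m + 1)

/-- The set of eigenvalues of the Kovalevskaya matrix `K^{(n)}` of the Riccati chain
is exactly `{k − n : k ∈ {0,1,…,m}, k ≠ n}`, i.e. the Kovalevskaya exponents are
`−n, −n+1, …, −1, 1, …, m−n`. -/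
theorem kovalevskayaMatrix_spectrum (m n : ℕ) (hm : 1 ≤ m) (hn1 : 1 ≤ n) (hnm : n ≤ m) :
    spectrum ℂ (kovalevskayaMatrix m n)
      = {μ : ℂ | ∃ k : ℕ, k ≤ m ∧ k ≠ n ∧ μ = (k : ℂ) - (n : ℂ)} := by
  ext μ
  rw [mem_spectrum_kovalevskayaMatrix_iff hm, Set.mem_ofPred_eq]
  have hprod := sub_mul_kovalevskayaSeq n (μ + n) m
  rw [Nat.descFactorial_eq_zero_iff_lt.2 (by omega : n < m + 1), Nat.cast_zero, sub_zero,
    add_sub_cancel_right] at hprod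
  constructor
  · intro h
    rw [h, mul_zero, eq_comm, Finset.prod_eq_zero_iff] at hprod
    obtain ⟨k, hk, hμ⟩ := hprod
    refine ⟨k, by simpa [Nat.lt_succ_iff] using hk, ?_, by linear_combination hμ⟩
    rintro rfl
    rw [sub_eq_zero.1 hμ] at h
    exact kovalevskayaSeq_self_ne_zero hnm h
  · rintro ⟨k, hk, hkn, rfl⟩
    rw [Finset.prod_eq_zero (Finset.mem_range.2 (Nat.lt_succ_of_le hk)) (by ring)] at hprod
    exact (mul_eq_zero.1 hprod).resolve_left (sub_ne_zero.2 (by exact_mod_cast hkn))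
end

section
/- Let n ≥ 1 be an integer and λ ∈ ℂ. Let A_n(λ) be the n×n complex matrix with entries a_{11} = 1 − 2n − λ, a_{kk} = k − n − λ for 2 ≤ k ≤ n, a_{k,k+1} = 1 for 1 ≤ k ≤ n−1, a_{k,1} = −(n)_k for 2 ≤ k ≤ n (where (n)_k = n(n−1)⋯(n−k+1) is the falling factorial), and all other entries 0. Then det(A_n(λ)) = ∏_{k=0}^{n−1} (k − n − λ). -/
/-- The matrix `A_n(lam)` (1-indexed entries: `a_{11} = 1 − 2n − lam`,
`a_{kk} = k − n − lam` for `2 ≤ k ≤ n`, `a_{k,k+1} = 1` for `1 ≤ k ≤ n−1`,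
`a_{k,1} = −(n)_k` for `2 ≤ k ≤ n`, all other entries `0`), written here with
`0`-indexed rows and columns; it is the upper-left `n × n` block of
`K^{(n)} − lam·I` in the Kovalevskaya exponent computation. -/
def Amat (n : ℕ) (lam : ℂ) : Matrix (Fin n) (Fin n) ℂ :=
  fun i j =>
    if (i : ℕ) = 0 ∧ (j : ℕ) = 0 then 1 - 2 * (n : ℂ) - lam
    else if (j : ℕ) = (i : ℕ) + 1 then 1
    else if i = j then ((i : ℕ) + 1 : ℂ) - (n : ℂ) - lam
    else if (j : ℕ) = 0 ∧ 2 ≤ (i : ℕ) + 1 ∧ (i : ℕ) + 1 ≤ n then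
      -(Nat.descFactorial n ((i : ℕ) + 1) : ℂ)
    else 0

section Hessenberg

variable {R : Type*} [CommRing R]

/-- The `n × n` matrix with first column `c`, diagonal entries `d 1, d 2, …` outside the first
column, ones on the superdiagonal and zeros elsewhere. -/
def columnHessenberg (n : ℕ) (c d : ℕ → R) : Matrix (Fin n) (Fin n) R :=
  fun i j =>
    if (j : ℕ) = 0 then c i
    else if (j : ℕ) = (i : ℕ) + 1 then 1
    else if (i : ℕ) = j then d i
    else 0

/-- Expansion of the determinant of `columnHessenberg` along the first row. -/
theorem det_columnHessenberg_succ_succ (m : ℕ) (c d : ℕ → R) :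
    (columnHessenberg (m + 2) c d).det =
      c 0 * ∏ j ∈ Finset.range (m + 1), d (j + 1) -
        (columnHessenberg (m + 1) (fun i => c (i + 1)) (fun i => d (i + 1))).det := by
  rw [Matrix.det_succ_row_zero, Fin.sum_univ_succ, Fin.sum_univ_succ, Finset.sum_eq_zero]
  · have hdiag : ((columnHessenberg (m + 2) c d).submatrix Fin.succ
        (Fin.succAbove 0)).det = ∏ j ∈ Finset.range (m + 1), d (j + 1) := by
      rw [← Matrix.det_transpose, Matrix.det_of_isLowerTriangular, ← Fin.prod_univ_eq_prod_range
        (fun j => d (j + 1))]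
      · simp [columnHessenberg]
      · intro i j hij
        have hij' : (i : ℕ) < j := hij
        simp only [columnHessenberg, Matrix.transpose_apply, Matrix.submatrix_apply,
          Fin.succAbove_zero, Fin.val_succ]
        grind
    have hminor : (columnHessenberg (m + 2) c d).submatrix Fin.succ
        (Fin.succAbove (Fin.succ 0)) =
          columnHessenberg (m + 1) (fun i => c (i + 1)) (fun i => d (i + 1)) := by
      ext i j
      refine Fin.cases ?_ (fun j => ?_) j
      · simp [columnHessenberg]
      · simp [columnHessenberg]
    rw [hdiag, hminor]
    simp [columnHessenberg]
    ring
  · intro j _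
    simp [columnHessenberg]

theorem det_columnHessenberg_descFactorial (x : R) (m k n : ℕ) (hn : n = k + m + 1) :
    (columnHessenberg (m + 1) (fun i => -(n.descFactorial (k + i + 1) : R))
      (fun i => x + (k + i + 1 : ℕ))).det =
      -(n.descFactorial (k + 1) : R) * ∏ j ∈ Finset.range m, (x + (k + 1 + j : ℕ)) := by
  induction m generalizing k with
  | zero => simp [columnHessenberg]
  | succ m ih =>
    rw [det_columnHessenberg_succ_succ]
    have h := ih (k + 1) (by omega)
    simp only [show ∀ i, k + 1 + i + 1 = k + (i + 1) + 1 by intro i; ring] at h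
    rw [h, Finset.prod_range_succ, Finset.prod_range_succ', Nat.descFactorial_succ n (k + 1),
      show n - (k + 1) = m + 1 by omega]
    simp only [show ∀ i, k + 1 + 1 + i = k + (i + 1) + 1 by intro i; ring,
      show ∀ i, k + 1 + (i + 1) = k + (i + 1) + 1 by intro i; ring]
    push_cast
    ring

end Hessenberg

/-- `det(A_n(lam)) = ∏_{k=0}^{n−1} (k − n − lam)`. -/
theorem Amat_det (n : ℕ) (hn : 1 ≤ n) (lam : ℂ) :
    (Amat n lam).det = ∏ k ∈ Finset.range n, ((k : ℂ) - (n : ℂ) - lam) := by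
  obtain _ | _ | m := n
  · omega
  · simp [Amat]
    ring
  · set N := m + 2 with hN
    have hA : Amat (m + 2) lam = columnHessenberg (m + 2)
        (fun i => if i = 0 then 1 - 2 * (N : ℂ) - lam else -(N.descFactorial (i + 1) : ℂ))
        (fun i => (-N - lam) + (i + 1 : ℕ)) := by
      ext i j
      have := i.isLt
      simp only [Amat, columnHessenberg, Fin.ext_iff]
      push_cast
      grind
    rw [hA, det_columnHessenberg_succ_succ]
    have h := det_columnHessenberg_descFactorial (-(N : ℂ) - lam) m 1 N (by omega)
    simp only [show ∀ i, 1 + i + 1 = i + 1 + 1 by intro i; ring] at h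
    simp only [Nat.add_eq_zero_iff, one_ne_zero, and_false, if_false, if_true]
    rw [h, Finset.prod_range_succ, Finset.prod_range_succ', Finset.prod_range_succ']
    have hprod : ∏ j ∈ Finset.range m, (-(N : ℂ) - lam + (1 + 1 + j : ℕ)) =
        ∏ j ∈ Finset.range m, (-(N : ℂ) - lam + (j + 1 + 1 : ℕ)) :=
      Finset.prod_congr rfl fun j _ => by push_cast; ring
    have hprod' : ∏ j ∈ Finset.range m, (((j + 1 + 1 : ℕ) : ℂ) - N - lam) =
        ∏ j ∈ Finset.range m, (-(N : ℂ) - lam + (j + 1 + 1 : ℕ)) :=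
      Finset.prod_congr rfl fun j _ => by ring
    rw [hprod, hprod']
    simp [Nat.descFactorial_succ, hN]
    ring
end

section
/- Let U ⊆ ℂ be open, c ∈ ℂ with c ≠ 0, m ≥ 1 an integer, and α_0, α_1, …, α_m : U → ℂ functions. Suppose f : U → ℂ is holomorphic, nonvanishing on U, and satisfies the linear equation f^{(m+1)}(z) + Σ_{j=1}^{m} α_j(z)·f^{(j)}(z) + c·α_0(z)·f(z) = 0 for all z ∈ U. Then u := f'/(c·f) satisfies the m-th Riccati chain equation (L^m u)(z) + Σ_{j=1}^{m} α_j(z)·(L^{j-1} u)(z) + α_0(z) = 0 for all z ∈ U, where (L g)(z) = g'(z) + c·u(z)·g(z) and L^k denotes the k-fold iterate. -/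
/-- The operator `L = d/dz + c·u` acting on functions: `(L g)(z) = g'(z) + c·u(z)·g(z)`. -/
noncomputable def riccatiL (c : ℂ) (u : ℂ → ℂ) (g : ℂ → ℂ) : ℂ → ℂ :=
  fun z => deriv g z + c * u z * g z

/-- The iterates of `L` on `u = f'/(c·f)` are `L^k u = f^{(k+1)}/(c·f)`. -/
theorem riccatiL_iterate_eq {U : Set ℂ} (hU : IsOpen U) {c : ℂ} (hc : c ≠ 0) {f : ℂ → ℂ}
    (hf : DifferentiableOn ℂ f U) (hf0 : ∀ z ∈ U, f z ≠ 0) (k : ℕ) :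
    ∀ z ∈ U, (riccatiL c fun w => deriv f w / (c * f w))^[k] (fun w => deriv f w / (c * f w)) z
      = iteratedDeriv (k + 1) f z / (c * f z) := by
  induction k with
  | zero => simp
  | succ k ih =>
    intro z hz
    have hfz : HasDerivAt f (deriv f z) z := (hf.differentiableAt (hU.mem_nhds hz)).hasDerivAt
    have hd : HasDerivAt (iteratedDeriv (k + 1) f) (iteratedDeriv (k + 2) f z) z := by
      rw [iteratedDeriv_succ (n := k + 1)]
      refine DifferentiableAt.hasDerivAt ?_
      rw [iteratedDeriv_eq_iterate]
      exact ((hf.analyticAt (hU.mem_nhds hz)).iterated_deriv (k + 1)).differentiableAt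
    have h0 := hf0 z hz
    rw [Function.iterate_succ_apply', riccatiL, ih z hz,
      (Filter.eventuallyEq_of_mem (hU.mem_nhds hz) ih).deriv_eq,
      (hd.fun_div (hfz.const_mul c) (mul_ne_zero hc h0)).deriv]
    field_simp
    ring

/-- If a holomorphic, nonvanishing `f` on an open set `U` satisfies the linear equation
`f^{(m+1)} + ∑_{j=1}^m α_j f^{(j)} + c·α_0·f = 0` on `U`, then `u = f'/(c·f)` satisfies
the `m`-th Riccati chain equation `L^m u + ∑_{j=1}^m α_j L^{j-1} u + α_0 = 0` on `U`. -/
theorem riccatiChain_of_linear (U : Set ℂ) (hU : IsOpen U) (c : ℂ) (hc : c ≠ 0)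
    (m : ℕ) (hm : 1 ≤ m) (α : ℕ → ℂ → ℂ)
    (f : ℂ → ℂ) (hf : DifferentiableOn ℂ f U) (hf0 : ∀ z ∈ U, f z ≠ 0)
    (hlin : ∀ z ∈ U, iteratedDeriv (m + 1) f z
        + (∑ j ∈ Finset.Icc 1 m, α j z * iteratedDeriv j f z) + c * α 0 z * f z = 0)
    (u : ℂ → ℂ) (hu : u = fun z => deriv f z / (c * f z)) :
    ∀ z ∈ U, (riccatiL c u)^[m] u z
        + (∑ j ∈ Finset.Icc 1 m, α j z * (riccatiL c u)^[j - 1] u z) + α 0 z = 0 := by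
  subst hu
  intro z hz
  have h0 := hf0 z hz
  have hsum : ∑ j ∈ Finset.Icc 1 m, α j z *
      (riccatiL c fun w => deriv f w / (c * f w))^[j - 1] (fun w => deriv f w / (c * f w)) z
      = (∑ j ∈ Finset.Icc 1 m, α j z * iteratedDeriv j f z) / (c * f z) := by
    rw [Finset.sum_div]
    refine Finset.sum_congr rfl fun j hj => ?_
    rw [riccatiL_iterate_eq hU hc hf hf0 _ z hz, Nat.sub_add_cancel (Finset.mem_Icc.mp hj).1,
      mul_div_assoc]
  rw [hsum, riccatiL_iterate_eq hU hc hf hf0 m z hz]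
  field_simp
  linear_combination hlin z hz
end
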